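/- For all integers n ≥ 1 and k ≥ 0 and every real number x, ĉ_{n,k}(x+1) = ĉ_{n,k}(x) − n · ĉ_{n−1,k}(x). -/

import Mathlib

/-- Unsigned Stirling numbers of the first kind:
`c(0,0)=1`, `c(n,m)=0` for `m>n` or (`n>0` and `m=0`), and `c(n+1,m)=n*c(n,m)+c(n,m-1)`. -/
def stirling1 : ℕ → ℕ → ℕ
  | 0, 0 => 1
  | 0, _ + 1 => 0
  | _ + 1, 0 => 0
  | n + 1, m + 1 => n * stirling1 n (m + 1) + stirling1 n m

/-- Stirling numbers of the second kind:
`S(0,0)=1`, `S(n,m)=0` for `m>n` or (`n>0` and `m=0`), and `S(n+1,m)=m*S(n,m)+S(n,m-1)`. -/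
def stirling2 : ℕ → ℕ → ℕ
  | 0, 0 => 1
  | 0, _ + 1 => 0
  | _ + 1, 0 => 0
  | n + 1, m + 1 => (m + 1) * stirling2 n (m + 1) + stirling2 n m

/-- Poly-Cauchy numbers of the second kind (negated upper index, unsigned):
`ĉ_{n,k} = Σ_{m=0}^n c(n,m)·(m+1)^k`. -/
def polyCauchy (n k : ℕ) : ℕ := ∑ m ∈ Finset.range (n + 1), stirling1 n m * (m + 1) ^ k

/-- Poly-Cauchy polynomial (of the second kind, negated upper index, unsigned):
`ĉ_{n,k}(z) = Σ_{m=0}^n c(n,m) · Σ_{i=0}^m C(m,i)·(−1)^i·(m−i+1)^k·z^i`. -/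
def polyCauchyPoly (n k : ℕ) (z : ℝ) : ℝ :=
  ∑ m ∈ Finset.range (n + 1), (stirling1 n m : ℝ) *
    ∑ i ∈ Finset.range (m + 1),
      (Nat.choose m i : ℝ) * (-1) ^ i * ((m - i + 1 : ℕ) : ℝ) ^ k * z ^ i

/-- Falling factorial `(z)_m = z(z−1)⋯(z−m+1)` of a real number. -/
def fallFact (z : ℝ) (m : ℕ) : ℝ := ∏ j ∈ Finset.range m, (z - j)

open Polynomial in
theorem ascPochhammer_eval_sub_one {R : Type*} [CommRing R] (n : ℕ) (y : R) :
    (ascPochhammer R (n + 1)).eval (y - 1) =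
      (ascPochhammer R (n + 1)).eval y - (n + 1) * (ascPochhammer R n).eval y := by
  rw [ascPochhammer_succ_eval n y, ascPochhammer_succ_left]
  simp only [eval_mul, eval_X, eval_comp, eval_add, eval_one, sub_add_cancel]
  ring

theorem stirling1_eq_zero_of_lt : ∀ {n m : ℕ}, n < m → stirling1 n m = 0
  | 0, m + 1, _ => by simp [stirling1]
  | n + 1, m + 1, h => by
    simp [stirling1, stirling1_eq_zero_of_lt (show n < m + 1 by omega),
      stirling1_eq_zero_of_lt (show n < m by omega)]

/-- The unsigned Stirling numbers of the first kind are the coefficients of the rising factorial. -/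
theorem sum_stirling1_mul_pow {R : Type*} [CommRing R] (n : ℕ) (y : R) :
    ∑ m ∈ Finset.range (n + 1), (stirling1 n m : R) * y ^ m = (ascPochhammer R n).eval y := by
  induction n with
  | zero => simp [stirling1]
  | succ n ih =>
    have h : ∑ m ∈ Finset.range (n + 1), (n : R) * (stirling1 n (m + 1) : R) * y ^ (m + 1) =
        n * ∑ m ∈ Finset.range (n + 1), (stirling1 n m : R) * y ^ m := by
      have h₀ : (n : R) * (stirling1 n 0 : R) = 0 := by cases n <;> simp [stirling1]
      rw [Finset.sum_range_succ, stirling1_eq_zero_of_lt (Nat.lt_succ_self n),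
        Finset.sum_range_succ' _ n, mul_add, Finset.mul_sum, ← mul_assoc, h₀]
      simp [mul_assoc]
    rw [ascPochhammer_succ_eval, ← ih, Finset.sum_range_succ']
    simp only [stirling1, Nat.cast_add, Nat.cast_mul, add_mul, Finset.sum_add_distrib, h]
    simp only [pow_succ, ← mul_assoc, ← Finset.sum_mul, Nat.cast_zero, zero_mul, add_zero]
    ring

/-- The linear functional on real polynomials sending `X ^ j` to `(j + 1) ^ k`. -/
noncomputable def polyCauchyFunctional (k : ℕ) : Polynomial ℝ →ₗ[ℝ] ℝ :=
  Polynomial.lsum fun j => (((j + 1 : ℕ) : ℝ) ^ k) • LinearMap.id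

open Polynomial in
theorem polyCauchyFunctional_X_pow (k j : ℕ) :
    polyCauchyFunctional k (X ^ j) = ((j + 1 : ℕ) : ℝ) ^ k := by
  simp [polyCauchyFunctional, X_pow_eq_monomial, sum_monomial_index]

open Polynomial in
theorem polyCauchyFunctional_X_sub_C_pow (k m : ℕ) (z : ℝ) :
    polyCauchyFunctional k ((X - C z) ^ m) =
      ∑ i ∈ Finset.range (m + 1),
        (Nat.choose m i : ℝ) * (-1) ^ i * ((m - i + 1 : ℕ) : ℝ) ^ k * z ^ i := by
  rw [sub_eq_neg_add, add_pow, map_sum]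
  refine Finset.sum_congr rfl fun i _ => ?_
  have h : (-C z) ^ i * X ^ (m - i) * (m.choose i : ℝ[X]) =
      ((m.choose i : ℝ) * (-1) ^ i * z ^ i) • X ^ (m - i) := by
    rw [smul_eq_C_mul, neg_pow]
    simp only [map_mul, map_pow, map_neg, map_one, map_natCast]
    ring
  rw [h, map_smul, polyCauchyFunctional_X_pow, smul_eq_mul]
  ring

open Polynomial in
theorem polyCauchyPoly_eq_functional (n k : ℕ) (z : ℝ) :
    polyCauchyPoly n k z =
      polyCauchyFunctional k ((ascPochhammer ℝ[X] n).eval (X - C z)) := by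
  rw [← sum_stirling1_mul_pow, map_sum, polyCauchyPoly]
  refine Finset.sum_congr rfl fun m _ => ?_
  rw [← polyCauchyFunctional_X_sub_C_pow, ← nsmul_eq_mul, ← nsmul_eq_mul, map_nsmul]

theorem polyCauchyPoly_succ_arg (n k : ℕ) (hn : 1 ≤ n) (x : ℝ) :
    polyCauchyPoly n k (x + 1) = polyCauchyPoly n k x - n * polyCauchyPoly (n - 1) k x := by
  obtain ⟨n, rfl⟩ := Nat.exists_eq_add_of_le' hn
  simp only [polyCauchyPoly_eq_functional, Nat.add_sub_cancel, map_add, map_one, ← sub_sub,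
    ascPochhammer_eval_sub_one, map_sub]
  rw [← Nat.cast_succ, ← nsmul_eq_mul, map_nsmul, nsmul_eq_mul]
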